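/- For every parking function a, Δ(Q_a) = Σ Q_{Park(a')} ⊗ Q_{Park(a'')}, summed over ordered pairs (a', a'') of subwords of a with F_{a'} ∩ F_{a''} = ∅ and F_{a'} ∪ F_{a''} = F_a. -/

import Mathlib

open scoped Classical

/-- Words on natural numbers (letters are intended to be positive integers). -/
abbrev W : Type := List ℕ

/-- `IsPF a` : the word `a` is a parking function, i.e. all its letters are
positive and its nondecreasing rearrangement `b₁ b₂ ⋯ bₙ` satisfies `bᵢ ≤ i`. -/
def IsPF (a : W) : Prop :=
  (∀ x ∈ a, 1 ≤ x) ∧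
    ∀ i, i < a.length → (a.insertionSort (· ≤ ·)).getD i 0 ≤ i + 1

/-- Split a word into the consecutive segments beginning at its
left-to-right minima (in the order in which they occur in the word). -/
def segs : W → List W
  | [] => []
  | x :: xs =>
      (x :: xs.takeWhile fun y => x ≤ y) :: segs (xs.dropWhile fun y => x ≤ y)
termination_by a => a.length
decreasing_by
  simpa using Nat.lt_succ_of_le (List.dropWhile_sublist _).length_le

/-- The LR-decomposition `F_a` of a word `a`: the sequence of segments beginning
at the left-to-right minima, listed in increasing order of their minimal letters
(i.e. in reverse order of occurrence in `a`). -/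
def LR (a : W) : List W := (segs a).reverse

/-- The word `w_k ⋯ w_2 w_1` encoded by an LR-decomposition `(w_1, …, w_k)`. -/
def wordOf (F : List W) : W := F.reverse.flatten

/-- A word is dominated if it is nonempty and its first letter is its minimal letter. -/
def Dominated (w : W) : Prop := w ≠ [] ∧ ∀ x ∈ w, w.headD 0 ≤ x

/-- The minimal letter of a word (`0` for the empty word). -/
def minW (w : W) : ℕ := (w.min?).getD 0

/-- Add `m` to every letter of a word. -/
def shiftW (m : ℕ) (w : W) : W := w.map (· + m)

/-- Add `m` to every letter of every word of a sequence of words. -/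
def shiftF (m : ℕ) (F : List W) : List W := F.map (shiftW m)

/-- The word whose LR-decomposition is the finite set of words `G`:
sort `G` increasingly (for dominated words with distinct minimal letters the
lexicographic order agrees with comparing the minimal letters) and concatenate
in decreasing order. -/
noncomputable def wordOfSet (G : Finset W) : W := (G.sort (· ≤ ·)).reverse.flatten

/-- Given vertex sets `X`, `Y` (of words) and a set `Θ` of edges, the resulting
set of words: concatenations `u ++ w` over edges `(u, w) ∈ Θ`, together with all
unmatched words of `X` and of `Y`. -/
noncomputable def glueSet (X Y : Finset W) (Θ : Finset (W × W)) : Finset W :=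
  Θ.image (fun p => p.1 ++ p.2) ∪
    X.filter (fun u => ∀ p ∈ Θ, p.1 ≠ u) ∪
    Y.filter (fun w => ∀ p ∈ Θ, p.2 ≠ w)

/-- `R(a,b)` : the set of matchings between `F_a` and `F_b + m` (`m` the length
of `a`), encoded as sets of edges in which no vertex occurs twice. -/
noncomputable def Rset (a b : W) : Finset (Finset (W × W)) :=
  ((LR a).toFinset ×ˢ (shiftF a.length (LR b)).toFinset).powerset.filter
    (fun Θ => ∀ p ∈ Θ, ∀ q ∈ Θ, (p.1 = q.1 ∨ p.2 = q.2) → p = q)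

/-- `aΘb` : the parking function whose LR-decomposition consists of the
concatenations `u ⬝ (w + m)` over the edges `(u, w + m)` of `Θ` together with all
unmatched words of `F_a` and of `F_b + m`. -/
noncomputable def mTheta (a b : W) (Θ : Finset (W × W)) : W :=
  wordOfSet (glueSet (LR a).toFinset (shiftF a.length (LR b)).toFinset Θ)

/-- `d(a) = min { i : #{ j : a_j ≤ i } < i }`. -/
def dVal (a : W) : ℕ :=
  Nat.find (p := fun i => (a.filter (fun x => x ≤ i)).length < i)
    ⟨a.length + 1, Nat.lt_succ_of_le (List.length_filter_le _ _)⟩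

/-- One step of the parkization algorithm: decrement every letter greater
than `d(a)`.  (This is the identity when `a` is a parking function.) -/
def parkStep (a : W) : W := a.map fun x => if dVal a < x then x - 1 else x

/-- Auxiliary fueled version of the parkization algorithm. -/
def parkFuel : ℕ → W → W
  | 0, a => a
  | k + 1, a => if dVal a = a.length + 1 then a else parkFuel k (parkStep a)

/-- The parkization `Park a` of a word `a`.  (For a word with positive letters
the algorithm needs at most `a.sum` steps, so the fuel below suffices.) -/
def Park (a : W) : W := parkFuel a.sum a

/-- The subword of `a` obtained by keeping exactly the words of `F_a`
belonging to `S`. -/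
def subWord (a : W) (S : Finset W) : W := wordOf ((LR a).filter (· ∈ S))

/-- The free module with basis indexed by words; the Hopf algebra `PFSym` is
its submodule spanned by `{M_a : a ∈ P}`. -/
abbrev FW (K : Type) [Field K] : Type := W →₀ K

/-- The monomial basis element `M_a`. -/
noncomputable def Mb (K : Type) [Field K] (a : W) : FW K := Finsupp.single a 1

/-- `M_a ⋆ M_b = Σ_{Θ ∈ R(a,b)} M_{aΘb}` on basis elements. -/
noncomputable def mulSingle (K : Type) [Field K] (a b : W) : FW K :=
  ∑ Θ ∈ Rset a b, Mb K (mTheta a b Θ)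

/-- The product `⋆`, extended bilinearly. -/
noncomputable def starF (K : Type) [Field K] (x y : FW K) : FW K :=
  x.sum fun a ca => y.sum fun b cb => (ca * cb) • mulSingle K a b

/-- The free module with basis indexed by pairs of words; it realizes the
tensor square of `FW K` via `M_a ⊗ M_b ↦ single (a,b)`. -/
abbrev FW2 (K : Type) [Field K] : Type := (W × W) →₀ K

/-- `Δ(M_a) = Σ M_{Park a'} ⊗ M_{Park a''}` over ordered pairs `(a', a'')` of
subwords of `a` with `F_{a'} ⊍ F_{a''} = F_a` (encoded by the subset
`S ⊆ F_a` of words kept in `a'`). -/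
noncomputable def deltaSingle (K : Type) [Field K] (a : W) : FW2 K :=
  ∑ S ∈ ((LR a).toFinset).powerset,
    Finsupp.single
      (Park (subWord a S), Park (subWord a (((LR a).toFinset) \ S))) 1

/-- The coproduct `Δ`, extended linearly. -/
noncomputable def deltaF (K : Type) [Field K] (x : FW K) : FW2 K :=
  x.sum fun a ca => ca • deltaSingle K a

/-- The componentwise product on the tensor square, on basis elements:
`(M_a ⊗ M_b) ⋆ (M_c ⊗ M_d) = (M_a ⋆ M_c) ⊗ (M_b ⋆ M_d)`. -/
noncomputable def star2Single (K : Type) [Field K] (p q : W × W) : FW2 K :=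
  ∑ Θ ∈ Rset p.1 q.1, ∑ Θ' ∈ Rset p.2 q.2,
    Finsupp.single (mTheta p.1 q.1 Θ, mTheta p.2 q.2 Θ') 1

/-- The componentwise product on the tensor square, extended bilinearly. -/
noncomputable def star2F (K : Type) [Field K] (x y : FW2 K) : FW2 K :=
  x.sum fun p cp => y.sum fun q cq => (cp * cq) • star2Single K p q

/-- The counit `ε` on basis elements. -/
noncomputable def epsW (K : Type) [Field K] (a : W) : K := if a = [] then 1 else 0

/-- `F_a ∘ F_b` : concatenate the `i`-th words of `F_a` and `F_b + m`
for `i ≤ min(r,s)` and keep the remaining unpaired words. -/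
def splitLR (F G : List W) : List W :=
  List.zipWith (· ++ ·) F G ++ F.drop G.length ++ G.drop F.length

/-- The split product `a ∘ b`. -/
def splitProd (a b : W) : W := wordOf (splitLR (LR a) (shiftF a.length (LR b)))

/-- A nonempty parking function is unsplitable if it is not the split product
of two nonempty parking functions. -/
def UnsplitablePF (a : W) : Prop :=
  IsPF a ∧ a ≠ [] ∧
    ¬ ∃ b c : W, IsPF b ∧ IsPF c ∧ b ≠ [] ∧ c ≠ [] ∧ a = splitProd b c

/-- The slash product `a | b = (b₁+m) ⋯ (bₙ+m) a₁ ⋯ a_m`. -/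
def slashProd (a b : W) : W := shiftW a.length b ++ a

/-- A nonempty parking function is atomic if it is not the slash product
of two nonempty parking functions. -/
def AtomicPF (a : W) : Prop :=
  IsPF a ∧ a ≠ [] ∧
    ¬ ∃ b c : W, IsPF b ∧ IsPF c ∧ b ≠ [] ∧ c ≠ [] ∧ a = slashProd b c

/-- `u ≺* v` : either `v` is a proper initial subword of `u`, or `u` is not a
proper initial subword of `v` and `u` precedes `v` lexicographically. -/
def precStar (u v : W) : Prop :=
  (v <+: u ∧ v ≠ u) ∨ (¬ (u <+: v ∧ u ≠ v) ∧ List.Lex (· < ·) u v)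

/-- `a ≺*_lex b` : `F_a` strictly precedes `F_b` in the lexicographic order
on sequences of words induced by `≺*`. -/
def precStarLex (a b : W) : Prop := List.Lex precStar (LR a) (LR b)

/-- The covering relation of `≤_*` : `b` covers `a` if `F_b` is obtained from
`F_a = (w_1, …, w_r)` by replacing `w_i` by `w_i ⬝ w_j` and removing `w_j`,
for some `i < j` such that every letter of `w_i` is at most every letter of `w_j`. -/
def CovStar (a b : W) : Prop :=
  ∃ i j, i < j ∧ j < (LR a).length ∧
    (∀ x ∈ (LR a).getD i [], ∀ y ∈ (LR a).getD j [], x ≤ y) ∧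
    LR b = ((LR a).set i ((LR a).getD i [] ++ (LR a).getD j [])).eraseIdx j

/-- The partial order `≤_*` on parking functions, generated by the covering
relations. -/
def leStar (a b : W) : Prop := Relation.ReflTransGen CovStar a b

/-- The finite set of all parking functions of length `n`. -/
noncomputable def pfFinset (n : ℕ) : Finset W :=
  ((Finset.univ : Finset (Fin n → Fin n)).image
      (fun f => List.ofFn fun i => (f i).val + 1)).filter IsPF

/-- The basis element `Q_a = Σ_{a ≤_* b} M_b`. -/
noncomputable def Qb (K : Type) [Field K] (a : W) : FW K :=
  ∑ b ∈ (pfFinset a.length).filter (fun b => leStar a b), Mb K b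

/-- `Q_x ⊗ Q_y` as an element of the tensor square. -/
noncomputable def QT (K : Type) [Field K] (x y : W) : FW2 K :=
  ∑ b ∈ (pfFinset x.length).filter (fun b => leStar x b),
    ∑ c ∈ (pfFinset y.length).filter (fun c => leStar y c),
      Finsupp.single (b, c) 1

/-- `a` is a nonincreasing word. -/
def NonInc (a : W) : Prop := a.Chain' (fun x y => y ≤ x)

/-- Every word of the LR-decomposition of `a` is nondecreasing. -/
def Nprop (a : W) : Prop := ∀ w ∈ LR a, w.Chain' (· ≤ ·)

/-- The words of the LR-decomposition of `a` have pairwise disjoint sets of letters. -/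
def Dprop (a : W) : Prop := (LR a).Pairwise (fun u v => ∀ x ∈ u, x ∉ v)

/-- `a` is a permutation of `{1, …, n}` viewed as a word. -/
def Sprop (a : W) : Prop := a.Perm (List.range' 1 a.length)


/-- First letter of a word. -/
def hd (w : W) : ℕ := w.headD 0

theorem segs_nil : segs [] = [] := by simp [segs]

theorem segs_cons (x : ℕ) (xs : W) : segs (x :: xs) =
    (x :: xs.takeWhile fun y => x ≤ y) :: segs (xs.dropWhile fun y => x ≤ y) := by
  rw [segs]

theorem segs_flatten (a : W) : (segs a).flatten = a := by
  induction a using segs.induct with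
  | case1 => simp [segs_nil]
  | case2 x xs ih => rw [segs_cons]; simp [ih]

/-- Sorted list of dominated words (heads decreasing). -/
def GLr (L : List W) : Prop :=
  (∀ w ∈ L, Dominated w) ∧ L.Pairwise (fun u v => hd v < hd u)

theorem hd_segs (a : W) (w : W) (L : List W) (h : segs a = w :: L) : hd w = hd a := by
  cases a with
  | nil => simp [segs_nil] at h
  | cons x xs => rw [segs_cons] at h; simp at h; rw [← h.1]; simp [hd]

theorem segs_good (a : W) : GLr (segs a) := by
  induction a using segs.induct with
  | case1 => simp [segs_nil, GLr]
  | case2 x xs ih =>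
    rw [segs_cons]
    refine ⟨?_, ?_⟩
    · intro w hw
      rcases List.mem_cons.1 hw with rfl | hw
      · refine ⟨by simp, ?_⟩
        intro y hy
        rcases List.mem_cons.1 hy with rfl | hy
        · simp
        · simpa using List.mem_takeWhile_imp hy
      · exact ih.1 w hw
    · refine List.pairwise_cons.2 ⟨?_, ih.2⟩
      intro w hw
      have hx : hd (x :: xs.takeWhile fun y => x ≤ y) = x := by simp [hd]
      rw [hx]
      cases hd1 : (xs.dropWhile fun y => x ≤ y) with
      | nil => rw [hd1] at hw; simp [segs_nil] at hw
      | cons y ys =>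
        have hy : y < x := by
          have := List.head_dropWhile_not (fun y => decide (x ≤ y)) (l := xs) (by rw [hd1]; simp)
          simp [hd1] at this
          exact this
        have ih2 := ih.2
        cases hs : segs (xs.dropWhile fun y => x ≤ y) with
        | nil => rw [hs] at hw; simp at hw
        | cons v L =>
          have hv := hd_segs _ _ _ hs
          rw [hs] at hw ih2
          rw [hd1] at hv
          have hv' : hd v = y := by rw [hv]; simp [hd]
          rcases List.mem_cons.1 hw with rfl | hw
          · omega
          · have := (List.pairwise_cons.1 ih2).1 w hw
            omega

theorem segs_of_good (L : List W) (h : GLr L) : segs L.flatten = L := by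
  induction L with
  | nil => simp [segs_nil]
  | cons w L ih =>
    have hw := h.1 w (by simp)
    have h2 := List.pairwise_cons.1 h.2
    have ih' := ih ⟨fun v hv => h.1 v (by simp [hv]), h2.2⟩
    cases w with
    | nil => exact absurd rfl hw.1
    | cons x xs =>
      have hxs : ∀ y ∈ xs, x ≤ y := fun y hy => by simpa using hw.2 y (by simp [hy])
      have hr : (L.flatten = []) ∨ ∃ y ys, L.flatten = y :: ys ∧ y < x := by
        cases L with
        | nil => simp
        | cons v L =>
          right
          have hv := h2.1 v (by simp)
          have hvd := h.1 v (by simp)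
          cases v with
          | nil => exact absurd rfl hvd.1
          | cons y ys => exact ⟨y, ys ++ L.flatten, by simp, by simpa [hd] using hv⟩
      have h1 : (xs ++ L.flatten).takeWhile (fun y => decide (x ≤ y)) = xs := by
        rw [List.takeWhile_append_of_pos (by simpa using hxs)]
        rcases hr with hr | ⟨y, ys, hr, hy⟩
        · simp [hr]
        · rw [hr]; simp [hy]
      have h2 : (xs ++ L.flatten).dropWhile (fun y => decide (x ≤ y)) = L.flatten := by
        rw [List.dropWhile_append_of_pos (by simpa using hxs)]
        rcases hr with hr | ⟨y, ys, hr, hy⟩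
        · simp [hr]
        · rw [hr]; simp [hy]
      rw [List.flatten_cons, List.cons_append, segs_cons, h1, h2, ih']

/-- Sorted list of dominated words (heads increasing). -/
def GdL (L : List W) : Prop :=
  (∀ w ∈ L, Dominated w) ∧ L.Pairwise (fun u v => hd u < hd v)

theorem GdL_rev (L : List W) : GLr L.reverse ↔ GdL L := by
  simp [GLr, GdL, List.pairwise_reverse]

theorem LR_good (a : W) : GdL (LR a) := by
  rw [← GdL_rev, LR, List.reverse_reverse]; exact segs_good a

theorem wordOf_LR (a : W) : wordOf (LR a) = a := by
  simp [wordOf, LR, segs_flatten]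

theorem LR_wordOf (L : List W) (h : GdL L) : LR (wordOf L) = L := by
  rw [LR, wordOf, segs_of_good _ ((GdL_rev L).2 h), List.reverse_reverse]

theorem GdL_nodup {L : List W} (h : GdL L) : L.Nodup :=
  h.2.imp (fun {u v} huv => by rintro rfl; exact lt_irrefl _ huv)

theorem GdL_ext {L L' : List W} (h : GdL L) (h' : GdL L') (e : L.toFinset = L'.toFinset) : L = L' := by
  have hp := List.perm_of_nodup_nodup_toFinset_eq (GdL_nodup h) (GdL_nodup h') e
  exact hp.eq_of_pairwise (fun u v _ _ h1 h2 => absurd (h1.trans h2) (lt_irrefl _)) h.2 h'.2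

theorem GdL_filter {L : List W} (p : W → Bool) (h : GdL L) : GdL (L.filter p) :=
  ⟨fun w hw => h.1 w (List.mem_of_mem_filter hw), h.2.filter _⟩

/-- The set of words of the decomposition. -/
def ph (a : W) : Finset W := (LR a).toFinset

/-- Good set of words. -/
def GS (X : Finset W) : Prop :=
  (∀ w ∈ X, Dominated w) ∧ ∀ u ∈ X, ∀ v ∈ X, hd u = hd v → u = v

theorem GdL_GS {L : List W} (h : GdL L) : GS L.toFinset := by
  refine ⟨fun w hw => h.1 w (by simpa using hw), ?_⟩
  intro u hu v hv e
  by_contra hne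
  have hp : L.Pairwise (fun u v => hd u ≠ hd v) := h.2.imp (fun h => h.ne)
  obtain ⟨i, hi, rfl⟩ := List.getElem_of_mem (List.mem_toFinset.1 hu)
  obtain ⟨j, hj, rfl⟩ := List.getElem_of_mem (List.mem_toFinset.1 hv)
  rcases lt_trichotomy i j with hij | rfl | hij
  · exact List.pairwise_iff_getElem.1 hp i j hi hj hij e
  · exact hne rfl
  · exact List.pairwise_iff_getElem.1 hp j i hj hi hij e.symm

theorem ph_good (a : W) : GS (ph a) := GdL_GS (LR_good a)

theorem ph_inj {a b : W} (h : ph a = ph b) : a = b := by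
  rw [← wordOf_LR a, ← wordOf_LR b, GdL_ext (LR_good a) (LR_good b) h]

theorem exists_GdL {X : Finset W} (h : GS X) : ∃ L, GdL L ∧ L.toFinset = X := by
  let r : W → W → Prop := fun u v => hd u ≤ hd v
  have : Std.Total r := ⟨fun a b => le_total _ _⟩
  have : IsTrans W r := ⟨fun a b c h1 h2 => le_trans h1 h2⟩
  have hm : ∀ x, x ∈ X.toList.insertionSort r ↔ x ∈ X := by simp
  refine ⟨X.toList.insertionSort r, ⟨fun w hw => h.1 w ((hm _).1 hw), ?_⟩, by ext x; simp⟩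
  have h1 := List.pairwise_insertionSort r X.toList
  have h2 : (X.toList.insertionSort r).Nodup :=
    (List.perm_insertionSort r X.toList).nodup_iff.2 X.nodup_toList
  refine (List.pairwise_iff_getElem.2 fun i j hi hj hij => ?_)
  have a1 := List.pairwise_iff_getElem.1 h1 i j hi hj hij
  have a2 := List.pairwise_iff_getElem.1 h2 i j hi hj hij
  refine lt_of_le_of_ne a1 fun e => a2 ?_
  exact h.2 _ ((hm _).1 (List.getElem_mem _)) _ ((hm _).1 (List.getElem_mem _)) e

theorem exists_ph {X : Finset W} (h : GS X) : ∃ a, ph a = X := by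
  obtain ⟨L, hL, e⟩ := exists_GdL h
  exact ⟨wordOf L, by rw [ph, LR_wordOf L hL, e]⟩

theorem GS_sub {X Y : Finset W} (h : GS X) (hY : Y ⊆ X) : GS Y :=
  ⟨fun w hw => h.1 w (hY hw), fun u hu v hv => h.2 u (hY hu) v (hY hv)⟩

theorem ph_subWord (a : W) (S : Finset W) (h : S ⊆ ph a) : ph (subWord a S) = S := by
  rw [ph, subWord, LR_wordOf _ (GdL_filter _ (LR_good a))]
  ext x
  have := @h x
  simp [ph] at this ⊢
  exact this

/-- `u` is letterwise below `v`. -/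
def Bel (u v : W) : Prop := ∀ x ∈ u, ∀ y ∈ v, x ≤ y

/-- Covering relation on sets. -/
def SCov (X Y : Finset W) : Prop :=
  ∃ u ∈ X, ∃ v ∈ X, u ≠ v ∧ Bel u v ∧ Y = insert (u ++ v) ((X.erase u).erase v)

theorem hd_append {u v : W} (h : u ≠ []) : hd (u ++ v) = hd u := by
  cases u with
  | nil => exact absurd rfl h
  | cons x xs => simp [hd]

theorem hd_mem {u : W} (h : u ≠ []) : hd u ∈ u := by
  cases u with
  | nil => exact absurd rfl h
  | cons x xs => simp [hd]

theorem dom_append {u v : W} (hu : Dominated u) (h : Bel u v) : Dominated (u ++ v) := by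
  refine ⟨by simp [hu.1], ?_⟩
  intro x hx
  change hd (u ++ v) ≤ x
  rw [hd_append hu.1]
  rcases List.mem_append.1 hx with hx | hx
  · exact hu.2 x hx
  · exact h _ (hd_mem hu.1) x hx

theorem SCov_good {X Y : Finset W} (h : SCov X Y) (hX : GS X) : GS Y := by
  obtain ⟨u, hu, v, hv, hne, hb, rfl⟩ := h
  have hun := (hX.1 u hu).1
  constructor
  · intro w hw
    simp only [Finset.mem_insert, Finset.mem_erase] at hw
    rcases hw with rfl | hw
    · exact dom_append (hX.1 u hu) hb
    · exact hX.1 w hw.2.2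
  · intro w hw w' hw' e
    simp only [Finset.mem_insert, Finset.mem_erase] at hw hw'
    rcases hw with rfl | hw <;> rcases hw' with rfl | hw'
    · rfl
    · rw [hd_append hun] at e
      exact absurd (hX.2 u hu w' hw'.2.2 e).symm hw'.2.1
    · rw [hd_append hun] at e
      exact absurd (hX.2 w hw.2.2 u hu e) hw.2.1
    · exact hX.2 w hw.2.2 w' hw'.2.2 e

theorem list_cov_finset {F : List W} (hF : GdL F) {i j : ℕ} (hij : i < j) (hj : j < F.length) :
    ((F.set i (F.getD i [] ++ F.getD j [])).eraseIdx j).toFinset =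
      insert (F.getD i [] ++ F.getD j []) ((F.toFinset.erase (F.getD i [])).erase (F.getD j [])) := by
  have hi : i < F.length := hij.trans hj
  have hn := GdL_nodup hF
  have e1 : F.getD i [] = F[i] := by simp [hi]
  have e2 : F.getD j [] = F[j] := by simp [hj]
  rw [e1, e2]
  ext x
  simp only [List.mem_toFinset, List.mem_eraseIdx_iff_getElem, Finset.mem_insert, Finset.mem_erase,
    List.getElem_set, List.length_set]
  constructor
  · rintro ⟨k, hk, hkj, rfl⟩
    split_ifs with h
    · left; rfl
    · right
      refine ⟨fun e => hkj ((hn.getElem_inj_iff).1 e), fun e => h ((hn.getElem_inj_iff).1 e).symm,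
        List.getElem_mem _⟩
  · rintro (rfl | ⟨h1, h2, h3⟩)
    · exact ⟨i, hi, hij.ne, by simp⟩
    · obtain ⟨k, hk, rfl⟩ := List.getElem_of_mem h3
      refine ⟨k, hk, ?_, ?_⟩
      · rintro rfl; exact h1 rfl
      · rw [if_neg]; rintro rfl; exact h2 rfl

theorem Cov_iff (a b : W) : CovStar a b ↔ SCov (ph a) (ph b) := by
  have hF := LR_good a
  have hn := GdL_nodup hF
  constructor
  · rintro ⟨i, j, hij, hj, hb, e⟩
    have hi : i < (LR a).length := hij.trans hj
    have e1 : (LR a).getD i [] = (LR a)[i] := by simp [hi]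
    have e2 : (LR a).getD j [] = (LR a)[j] := by simp [hj]
    refine ⟨(LR a).getD i [], ?_, (LR a).getD j [], ?_, ?_, hb, ?_⟩
    · rw [e1]; simp [ph]
    · rw [e2]; simp [ph]
    · rw [e1, e2]; intro h; exact hij.ne ((hn.getElem_inj_iff).1 h)
    · rw [ph, e, list_cov_finset hF hij hj]; rfl
  · intro hc
    obtain ⟨u, hu, v, hv, hne, hb, e⟩ := hc
    obtain ⟨i, hi, rfl⟩ := List.getElem_of_mem (List.mem_toFinset.1 hu)
    obtain ⟨j, hj, rfl⟩ := List.getElem_of_mem (List.mem_toFinset.1 hv)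
    have e1 : (LR a).getD i [] = (LR a)[i] := by simp [hi]
    have e2 : (LR a).getD j [] = (LR a)[j] := by simp [hj]
    have hdu := hF.1 _ (List.getElem_mem hi)
    have hdv := hF.1 _ (List.getElem_mem hj)
    have hij : i < j := by
      by_contra hlt
      have hne' : i ≠ j := by rintro rfl; exact hne rfl
      have := List.pairwise_iff_getElem.1 hF.2 j i hj hi (by omega)
      have := hb _ (hd_mem hdu.1) _ (hd_mem hdv.1)
      omega
    refine ⟨i, j, hij, hj, by rw [e1, e2]; exact hb, ?_⟩
    have hset : GdL ((LR a).set i ((LR a).getD i [] ++ (LR a).getD j [])) := by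
      rw [e1, e2]
      constructor
      · intro w hw
        rcases List.mem_or_eq_of_mem_set hw with hw | rfl
        · exact hF.1 w hw
        · exact dom_append hdu hb
      · have : (((LR a).set i ((LR a)[i] ++ (LR a)[j])).map hd).Pairwise (· < ·) := by
          rw [List.map_set, hd_append hdu.1]
          have : ((LR a).map hd).set i (hd (LR a)[i]) = (LR a).map hd := by
            apply List.ext_getElem (by simp)
            intro n h1 h2
            rw [List.getElem_set]
            split_ifs with h
            · subst h; simp
            · rfl
          rw [this]
          exact List.pairwise_map.2 hF.2
        exact List.pairwise_map.1 this
    refine GdL_ext (LR_good b) ⟨fun w hw => hset.1 w (List.mem_of_mem_eraseIdx hw),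
      hset.2.sublist (List.eraseIdx_sublist _ _)⟩ ?_
    rw [list_cov_finset hF hij hj, e1, e2]
    exact e

/-- The order on sets. -/
def SLe : Finset W → Finset W → Prop := Relation.ReflTransGen SCov

theorem SLe_good {X Y : Finset W} (h : SLe X Y) (hX : GS X) : GS Y := by
  induction h with
  | refl => exact hX
  | tail _ h ih => exact SCov_good h ih

theorem leStar_iff (a b : W) : leStar a b ↔ SLe (ph a) (ph b) := by
  constructor
  · intro h
    induction h with
    | refl => exact .refl
    | tail _ h ih => exact ih.tail ((Cov_iff _ _).1 h)
  · intro h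
    generalize hY : ph b = Y at h
    induction h generalizing b with
    | refl => rw [ph_inj hY]; exact .refl
    | tail h1 h2 ih =>
      obtain ⟨c, hc⟩ := exists_ph (SLe_good h1 (ph_good a))
      refine (ih c hc).tail ((Cov_iff _ _).2 ?_)
      rw [hc, hY]; exact h2

theorem SCov_union {X Y Z : Finset W} (h : SCov X Y) (hG : GS (X ∪ Z)) (hd' : Disjoint X Z) :
    SCov (X ∪ Z) (Y ∪ Z) ∧ Disjoint Y Z := by
  obtain ⟨u, hu, v, hv, hne, hb, rfl⟩ := h
  have huZ : u ∉ Z := Finset.disjoint_left.1 hd' hu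
  have hvZ : v ∉ Z := Finset.disjoint_left.1 hd' hv
  refine ⟨⟨u, by simp [hu], v, by simp [hv], hne, hb, ?_⟩, ?_⟩
  · ext w
    simp only [Finset.mem_union, Finset.mem_insert, Finset.mem_erase]
    constructor
    · rintro ((h | h) | h)
      · exact Or.inl h
      · exact Or.inr ⟨h.1, h.2.1, Or.inl h.2.2⟩
      · refine Or.inr ⟨?_, ?_, Or.inr h⟩
        · rintro rfl; exact hvZ h
        · rintro rfl; exact huZ h
    · rintro (h | ⟨h1, h2, h | h⟩)
      · exact Or.inl (Or.inl h)
      · exact Or.inl (Or.inr ⟨h1, h2, h⟩)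
      · exact Or.inr h
  · rw [Finset.disjoint_left]
    intro w hw hwZ
    simp only [Finset.mem_insert, Finset.mem_erase] at hw
    rcases hw with rfl | hw
    · have hun := (hG.1 u (by simp [hu])).1
      have := hG.2 (u ++ v) (by simp [hwZ]) u (by simp [hu]) (hd_append hun)
      rw [this] at hwZ
      exact huZ hwZ
    · exact Finset.disjoint_left.1 hd' hw.2.2 hwZ

theorem SLe_union {X Y Z : Finset W} (h : SLe X Y) (hG : GS (X ∪ Z)) (hd' : Disjoint X Z) :
    SLe (X ∪ Z) (Y ∪ Z) ∧ Disjoint Y Z := by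
  induction h with
  | refl => exact ⟨.refl, hd'⟩
  | tail h1 h2 ih =>
    have := SCov_union h2 (SLe_good ih.1 hG) ih.2
    exact ⟨ih.1.tail this.1, this.2⟩

theorem SLe_union2 {S S' C D : Finset W} (h : SLe S C) (h' : SLe S' D) (hG : GS (S ∪ S'))
    (hd' : Disjoint S S') : SLe (S ∪ S') (C ∪ D) ∧ Disjoint C D := by
  have h1 := SLe_union h hG hd'
  have hG1 := SLe_good h1.1 hG
  rw [Finset.union_comm] at hG1
  have h2 := SLe_union h' hG1 h1.2.symm
  rw [Finset.union_comm S' C, Finset.union_comm D C] at h2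
  exact ⟨h1.1.trans h2.1, h2.2.symm⟩

theorem SCov_split {X Y T : Finset W} (h : SCov X Y) (hG : GS X) (hT : T ⊆ Y) :
    ∃ S ⊆ X, SLe S T ∧ SLe (X \ S) (Y \ T) := by
  obtain ⟨u, hu, v, hv, hne, hb, rfl⟩ := h
  have hun := (hG.1 u hu).1
  have hvn := (hG.1 v hv).1
  have key : u ++ v ∈ X → u ++ v = u := fun h => hG.2 _ h u hu (hd_append hun)
  have hX : u ++ v ∉ X := by
    intro h; have := key h; simp at this; exact hvn this
  by_cases hm : u ++ v ∈ T
  · refine ⟨insert u (insert v (T.erase (u ++ v))), ?_, ?_, ?_⟩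
    · intro w hw
      simp only [Finset.mem_insert, Finset.mem_erase] at hw
      rcases hw with rfl | rfl | hw
      · exact hu
      · exact hv
      · have := hT hw.2
        simp only [Finset.mem_insert, Finset.mem_erase] at this
        tauto
    · refine .single ⟨u, by simp, v, by simp, hne, hb, ?_⟩
      ext w
      have := @hT w
      simp only [Finset.mem_insert, Finset.mem_erase] at this ⊢
      by_cases hw : w = u ++ v
      · subst hw; tauto
      · tauto
    · have : X \ insert u (insert v (T.erase (u ++ v))) =
          insert (u ++ v) ((X.erase u).erase v) \ T := by
        ext w
        simp only [Finset.mem_insert, Finset.mem_erase, Finset.mem_sdiff]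
        by_cases hw : w = u ++ v
        · subst hw; tauto
        · tauto
      rw [this]; exact .refl
  · refine ⟨T, ?_, .refl, ?_⟩
    · intro w hw
      have := hT hw
      simp only [Finset.mem_insert, Finset.mem_erase] at this
      rcases this with rfl | h
      · exact absurd hw hm
      · exact h.2.2
    · have hT' : ∀ w ∈ T, w ≠ u ∧ w ≠ v := by
        intro w hw
        have := hT hw
        simp only [Finset.mem_insert, Finset.mem_erase] at this
        rcases this with rfl | h
        · exact absurd hw hm
        · exact ⟨h.2.1, h.1⟩
      refine .single ⟨u, ?_, v, ?_, hne, hb, ?_⟩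
      · exact Finset.mem_sdiff.2 ⟨hu, fun h => (hT' u h).1 rfl⟩
      · exact Finset.mem_sdiff.2 ⟨hv, fun h => (hT' v h).2 rfl⟩
      · ext w
        simp only [Finset.mem_insert, Finset.mem_erase, Finset.mem_sdiff]
        by_cases hw : w = u ++ v
        · subst hw; tauto
        · tauto

theorem SLe_split {X Y T : Finset W} (h : SLe X Y) (hG : GS X) (hT : T ⊆ Y) :
    ∃ S ⊆ X, SLe S T ∧ SLe (X \ S) (Y \ T) := by
  induction h generalizing T with
  | refl => exact ⟨T, hT, .refl, .refl⟩
  | tail h1 h2 ih =>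
    obtain ⟨S1, hS1, a1, a2⟩ := SCov_split h2 (SLe_good h1 hG) hT
    obtain ⟨S, hS, b1, b2⟩ := ih hS1
    exact ⟨S, hS, b1.trans a1, b2.trans a2⟩

theorem SLe_decomp {X Y : Finset W} (h : SLe X Y) :
    (∀ w ∈ X, ∃ L : List W, (∀ v ∈ L, v ∈ X) ∧ w ∈ L ∧ L.flatten ∈ Y) ∧
    (∀ c ∈ Y, ∃ L : List W, (∀ v ∈ L, v ∈ X) ∧ L.flatten = c) := by
  induction h with
  | refl => exact ⟨fun w hw => ⟨[w], by simpa using hw, by simp, by simpa using hw⟩,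
      fun w hw => ⟨[w], by simpa using hw, by simp⟩⟩
  | tail h1 h2 ih =>
    obtain ⟨u, hu, v, hv, hne, hb, rfl⟩ := h2
    obtain ⟨Lu, hLu, eu⟩ := ih.2 u hu
    obtain ⟨Lv, hLv, ev⟩ := ih.2 v hv
    have huv : ∀ w ∈ Lu ++ Lv, w ∈ X := by
      intro w hw
      rcases List.mem_append.1 hw with hw | hw
      · exact hLu w hw
      · exact hLv w hw
    constructor
    · intro w hw
      obtain ⟨L, hL, hwL, hm⟩ := ih.1 w hw
      by_cases e1 : L.flatten = u
      · exact ⟨L ++ Lv, by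
          intro w hw
          rcases List.mem_append.1 hw with hw | hw
          · exact hL w hw
          · exact hLv w hw, by simp [hwL], by simp [e1, ev]⟩
      · by_cases e2 : L.flatten = v
        · exact ⟨Lu ++ L, by
            intro w hw
            rcases List.mem_append.1 hw with hw | hw
            · exact hLu w hw
            · exact hL w hw, by simp [hwL], by simp [e2, eu]⟩
        · refine ⟨L, hL, hwL, ?_⟩
          simp only [Finset.mem_insert, Finset.mem_erase]
          exact Or.inr ⟨e2, e1, hm⟩
    · intro c hc
      simp only [Finset.mem_insert, Finset.mem_erase] at hc
      rcases hc with rfl | hc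
      · exact ⟨Lu ++ Lv, huv, by simp [eu, ev]⟩
      · exact ih.2 c hc.2.2

theorem code_unique {A : Finset W} (hA : GS A) :
    ∀ L L' : List W, (∀ v ∈ L, v ∈ A) → (∀ v ∈ L', v ∈ A) → L.flatten = L'.flatten → L = L' := by
  intro L
  induction L with
  | nil =>
    intro L' _ h' e
    cases L' with
    | nil => rfl
    | cons w L' =>
      simp at e
      exact absurd e.1 (hA.1 w (h' w (by simp))).1
  | cons u L ih =>
    intro L' h h' e
    have hu := h u (by simp)
    have hun := (hA.1 u hu).1
    cases L' with
    | nil => simp at e; exact absurd e.1 hun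
    | cons w L' =>
      have hw := h' w (by simp)
      have hwn := (hA.1 w hw).1
      simp only [List.flatten_cons] at e
      have : hd u = hd w := by
        rw [← hd_append hun (v := L.flatten), e, hd_append hwn]
      have := hA.2 u hu w hw this
      subst this
      rw [ih L' (fun v hv => h v (by simp [hv])) (fun v hv => h' v (by simp [hv]))
        (List.append_cancel_left e)]

theorem S_unique {A S1 S2 C : Finset W} (hA : GS A) (h1 : S1 ⊆ A) (h2 : S2 ⊆ A)
    (c1 : SLe S1 C) (c2 : SLe S2 C) : S1 = S2 := by
  have key : ∀ S1 S2 : Finset W, S1 ⊆ A → S2 ⊆ A → SLe S1 C → SLe S2 C → S1 ⊆ S2 := by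
    intro S1 S2 h1 h2 c1 c2 w hw
    obtain ⟨L, hL, hwL, hm⟩ := (SLe_decomp c1).1 w hw
    obtain ⟨L', hL', e⟩ := (SLe_decomp c2).2 _ hm
    have := code_unique hA L L' (fun v hv => h1 (hL v hv)) (fun v hv => h2 (hL' v hv)) e.symm
    subst this
    exact hL' w hwL
  exact (key _ _ h1 h2 c1 c2).antisymm (key _ _ h2 h1 c2 c1)

theorem sum_ph (a : W) : ∑ w ∈ ph a, (w : Multiset ℕ) = (a : Multiset ℕ) := by
  rw [ph, List.sum_toFinset _ (GdL_nodup (LR_good a))]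
  have : ∀ L : List W, (L.map (fun w : W => (w : Multiset ℕ))).sum = (L.flatten : Multiset ℕ) := by
    intro L
    induction L with
    | nil => simp
    | cons w L ih => simp [ih]
  rw [this, Multiset.coe_eq_coe]
  have := (List.reverse_perm (segs a)).flatten
  rwa [segs_flatten] at this

theorem SCov_sum {X Y : Finset W} (h : SCov X Y) (hG : GS X) :
    ∑ w ∈ Y, (w : Multiset ℕ) = ∑ w ∈ X, (w : Multiset ℕ) := by
  obtain ⟨u, hu, v, hv, hne, hb, rfl⟩ := h
  have hun := (hG.1 u hu).1
  have hvn := (hG.1 v hv).1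
  have hX : u ++ v ∉ X := by
    intro h; have := hG.2 _ h u hu (hd_append hun); simp at this; exact hvn this
  rw [Finset.sum_insert (by simp [hX]), ← Finset.add_sum_erase X _ hu,
    ← Finset.add_sum_erase (X.erase u) _ (Finset.mem_erase.2 ⟨hne.symm, hv⟩), ← Multiset.coe_add,
    add_assoc]

theorem leStar_perm {a b : W} (h : leStar a b) : b.Perm a := by
  induction h with
  | refl => exact .refl _
  | tail h1 h2 ih =>
    refine List.Perm.trans ?_ ih
    have := SCov_sum ((Cov_iff _ _).1 h2) (ph_good _)
    rw [sum_ph, sum_ph, Multiset.coe_eq_coe] at this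
    exact this

theorem LR_map {a : W} {g : ℕ → ℕ} (hg : StrictMonoOn g {x | x ∈ a}) :
    LR (a.map g) = (LR a).map (List.map g) := by
  have hm : ∀ w ∈ LR a, ∀ x ∈ w, x ∈ a := by
    intro w hw x hx
    rw [← wordOf_LR a, wordOf]
    exact List.mem_flatten.2 ⟨w, by simpa using hw, hx⟩
  have hh : ∀ w : W, w ≠ [] → hd (w.map g) = g (hd w) := by
    intro w hw
    cases w with
    | nil => exact absurd rfl hw
    | cons x xs => simp [hd]
  have hL := LR_good a
  have hG : GdL ((LR a).map (List.map g)) := by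
    constructor
    · intro w hw
      obtain ⟨v, hv, rfl⟩ := List.mem_map.1 hw
      have hvd := hL.1 v hv
      refine ⟨by simpa using hvd.1, ?_⟩
      intro x hx
      obtain ⟨y, hy, rfl⟩ := List.mem_map.1 hx
      change hd (v.map g) ≤ _
      rw [hh v hvd.1]
      exact hg.monotoneOn (hm v hv _ (hd_mem hvd.1)) (hm v hv _ hy) (hvd.2 y hy)
    · rw [List.pairwise_map]
      refine hL.2.imp_of_mem ?_
      intro u v hu hv huv
      rw [hh u (hL.1 u hu).1, hh v (hL.1 v hv).1]
      exact hg (hm u hu _ (hd_mem (hL.1 u hu).1)) (hm v hv _ (hd_mem (hL.1 v hv).1)) huv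
  rw [← LR_wordOf _ hG]
  congr 1
  conv_lhs => rw [← wordOf_LR a]
  simp [wordOf, List.map_flatten]

theorem Cov_map {a b : W} {g : ℕ → ℕ} (hg : StrictMonoOn g {x | x ∈ a}) (h : CovStar a b) :
    CovStar (a.map g) (b.map g) := by
  have hp : b.Perm a := leStar_perm (.single h)
  have hgb : StrictMonoOn g {x | x ∈ b} := by
    have : {x | x ∈ b} = {x | x ∈ a} := by ext x; exact hp.mem_iff
    rwa [this]
  have hm : ∀ w ∈ LR a, ∀ x ∈ w, x ∈ a := by
    intro w hw x hx
    rw [← wordOf_LR a, wordOf]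
    exact List.mem_flatten.2 ⟨w, by simpa using hw, hx⟩
  obtain ⟨i, j, hij, hj, hb, e⟩ := h
  have hi := hij.trans hj
  have e1 : (LR a).getD i [] = (LR a)[i] := by simp [hi]
  have e2 : (LR a).getD j [] = (LR a)[j] := by simp [hj]
  rw [e1, e2] at e hb
  have e1' : ((LR a).map (List.map g)).getD i [] = (LR a)[i].map g := by simp [hi]
  have e2' : ((LR a).map (List.map g)).getD j [] = (LR a)[j].map g := by simp [hj]
  refine ⟨i, j, hij, ?_, ?_, ?_⟩
  · rw [LR_map hg]; simpa using hj
  · rw [LR_map hg, e1', e2']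
    intro x hx y hy
    obtain ⟨x, hx', rfl⟩ := List.mem_map.1 hx
    obtain ⟨y, hy', rfl⟩ := List.mem_map.1 hy
    exact hg.monotoneOn (hm _ (List.getElem_mem _) _ hx') (hm _ (List.getElem_mem _) _ hy')
      (hb x hx' y hy')
  · rw [LR_map hg, LR_map hgb, e1', e2', e, ← List.map_append, ← List.map_set, List.eraseIdx_map]

theorem leStar_map {a b : W} {g : ℕ → ℕ} (hg : StrictMonoOn g {x | x ∈ a}) (h : leStar a b) :
    leStar (a.map g) (b.map g) := by
  induction h with
  | refl => exact .refl
  | tail h1 h2 ih =>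
    refine ih.tail (Cov_map ?_ h2)
    have hp := leStar_perm h1
    refine hg.mono ?_
    intro x hx; exact hp.mem_iff.1 hx

theorem leStar_map_rev {a b : W} {g : ℕ → ℕ} (hg : StrictMonoOn g {x | x ∈ a})
    (h : leStar (a.map g) b) : ∃ c, leStar a c ∧ b = c.map g := by
  let h' := Function.invFunOn g {x | x ∈ a}
  have hl : ∀ x ∈ a, h' (g x) = x := fun x hx => hg.injOn.leftInvOn_invFunOn hx
  have hm : StrictMonoOn h' {x | x ∈ a.map g} := by
    intro x hx y hy hxy
    obtain ⟨x, hx', rfl⟩ := List.mem_map.1 hx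
    obtain ⟨y, hy', rfl⟩ := List.mem_map.1 hy
    rw [hl x hx', hl y hy']
    exact (hg.lt_iff_lt hx' hy').1 hxy
  have h1 := leStar_map hm h
  have h2 : (a.map g).map h' = a := by
    rw [List.map_map]
    conv_rhs => rw [← List.map_id a]
    exact List.map_congr_left fun x hx => hl x hx
  rw [h2] at h1
  refine ⟨_, h1, ?_⟩
  rw [List.map_map]
  conv_lhs => rw [← List.map_id b]
  refine List.map_congr_left fun x hx => ?_
  have hx' := (leStar_perm h).mem_iff.1 hx
  obtain ⟨y, hy, rfl⟩ := List.mem_map.1 hx'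
  simp [hl y hy]

theorem map_inj_of {u b c : W} {g : ℕ → ℕ} (hg : StrictMonoOn g {x | x ∈ u})
    (hb : b.Perm u) (hc : c.Perm u) (e : b.map g = c.map g) : b = c := by
  have hl : ∀ x ∈ u, Function.invFunOn g {x | x ∈ u} (g x) = x :=
    fun x hx => hg.injOn.leftInvOn_invFunOn hx
  have key : ∀ b : W, b.Perm u → (b.map g).map (Function.invFunOn g {x | x ∈ u}) = b := by
    intro b hb
    rw [List.map_map]
    conv_rhs => rw [← List.map_id b]
    exact List.map_congr_left fun x hx => hl x (hb.mem_iff.1 hx)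
  rw [← key b hb, e, key c hc]

theorem IsPF_perm {a b : W} (h : a.Perm b) (ha : IsPF a) : IsPF b := by
  have e : a.insertionSort (· ≤ ·) = b.insertionSort (· ≤ ·) := by
    refine List.Perm.eq_of_pairwise (le := (· ≤ ·)) (fun x y _ _ h1 h2 => le_antisymm h1 h2)
      (List.pairwise_insertionSort _ _) (List.pairwise_insertionSort _ _) ?_
    exact ((List.perm_insertionSort _ a).trans h).trans (List.perm_insertionSort _ b).symm
  refine ⟨fun x hx => ha.1 x (h.mem_iff.2 hx), ?_⟩
  rw [← e, ← h.length_eq]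
  exact ha.2

theorem IsPF_le {a : W} (ha : IsPF a) : ∀ x ∈ a, x ≤ a.length := by
  intro x hx
  have hx' : x ∈ a.insertionSort (· ≤ ·) := by simpa using hx
  obtain ⟨i, hi, rfl⟩ := List.getElem_of_mem hx'
  have hi' : i < a.length := by simpa using hi
  have := ha.2 i hi'
  rw [List.getD_eq_getElem _ _ hi] at this
  omega

theorem mem_pfFinset (n : ℕ) (b : W) : b ∈ pfFinset n ↔ b.length = n ∧ IsPF b := by
  simp only [pfFinset, Finset.mem_filter, Finset.mem_image, Finset.mem_univ, true_and]
  constructor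
  · rintro ⟨⟨f, rfl⟩, h⟩
    exact ⟨by simp, h⟩
  · rintro ⟨rfl, h⟩
    refine ⟨⟨fun i => ⟨b[i] - 1, ?_⟩, ?_⟩, h⟩
    · have h1 := h.1 b[i] (List.getElem_mem _)
      have h2 := IsPF_le h b[i] (List.getElem_mem _)
      omega
    · apply List.ext_getElem (by simp)
      intro i h1 h2
      have h1 := h.1 b[i] (List.getElem_mem _)
      simp
      omega

theorem IsPF_of_count {a : W} (hp : ∀ x ∈ a, 1 ≤ x)
    (h : ∀ i ≤ a.length, i ≤ (a.filter (fun x => x ≤ i)).length) : IsPF a := by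
  refine ⟨hp, fun i hi => ?_⟩
  by_contra hlt
  set s := a.insertionSort (· ≤ ·) with hs
  have hsl : i < s.length := by simpa [hs] using hi
  rw [List.getD_eq_getElem _ _ hsl] at hlt
  have hsp : s.Pairwise (· ≤ ·) := List.pairwise_insertionSort _ _
  have h1 := h (i + 1) hi
  have hperm : s.Perm a := List.perm_insertionSort _ _
  rw [← (hperm.filter _).length_eq, ← List.take_append_drop i s, List.filter_append,
    List.length_append] at h1
  have h2 : ((s.drop i).filter (fun x => x ≤ i + 1)) = [] := by
    rw [List.filter_eq_nil_iff]
    intro x hx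
    obtain ⟨k, hk, rfl⟩ := List.getElem_of_mem hx
    rw [List.getElem_drop]
    have hk' : i + k < s.length := by simp at hk; omega
    have : s[i] ≤ s[i + k] := by
      rcases Nat.eq_zero_or_pos k with rfl | hk0
      · simp
      · exact List.pairwise_iff_getElem.1 hsp i (i + k) hsl hk' (by omega)
    simp; omega
  have h3 := List.length_filter_le (fun x => decide (x ≤ i + 1)) (s.take i)
  rw [h2] at h1
  simp at h1 h3
  omega

theorem dVal_perm {a b : W} (h : a.Perm b) : dVal a = dVal b := by
  have : ∀ i, (a.filter (fun x => x ≤ i)).length = (b.filter (fun x => x ≤ i)).length :=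
    fun i => (h.filter _).length_eq
  unfold dVal
  apply Nat.find_congr'
  intro i
  rw [this i]

theorem dVal_spec (a : W) : (a.filter (fun x => x ≤ dVal a)).length < dVal a :=
  Nat.find_spec (p := fun i => (a.filter (fun x => x ≤ i)).length < i) _

theorem dVal_min (a : W) {i : ℕ} (h : i < dVal a) : i ≤ (a.filter (fun x => x ≤ i)).length :=
  not_lt.1 (Nat.find_min (p := fun i => (a.filter (fun x => x ≤ i)).length < i) _ h)

theorem dVal_le (a : W) : dVal a ≤ a.length + 1 :=
  Nat.find_le (p := fun i => (a.filter (fun x => x ≤ i)).length < i)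
    (Nat.lt_succ_of_le (List.length_filter_le _ _))

theorem dVal_notMem (a : W) : dVal a ∉ a := by
  intro hm
  have h1 := dVal_spec a
  have hpos : 0 < dVal a := by omega
  have h2 := dVal_min a (i := dVal a - 1) (by omega)
  have h3 : (a.filter (fun x => x ≤ dVal a - 1)).length < (a.filter (fun x => x ≤ dVal a)).length := by
    have hsub : List.Sublist (a.filter (fun x => decide (x ≤ dVal a - 1)))
        (a.filter (fun x => decide (x ≤ dVal a))) := by
      apply List.monotone_filter_right
      intro x hx
      simp at hx ⊢; omega
    refine lt_of_le_of_ne hsub.length_le fun e => ?_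
    have := hsub.eq_of_length e
    have hm' : dVal a ∈ a.filter (fun x => decide (x ≤ dVal a)) := by simp [hm]
    rw [← this] at hm'
    simp at hm'
    omega
  omega

/-- One parkization step on letters. -/
def stepL (d : ℕ) (x : ℕ) : ℕ := if d < x then x - 1 else x

theorem parkStep_eq (a : W) : parkStep a = a.map (stepL (dVal a)) := rfl

theorem sum_map_lt (g : ℕ → ℕ) : ∀ a : W, (∀ x ∈ a, g x ≤ x) → (∃ x ∈ a, g x < x) →
    (a.map g).sum < a.sum := by
  intro a h h'
  have := List.sum_lt_sum (l := a) g id (by simpa using h) (by simpa using h')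
  simpa using this

theorem parkFuel_spec : ∀ (k : ℕ) (u : W), (∀ x ∈ u, 1 ≤ x) → u.sum ≤ k →
    ∃ g : ℕ → ℕ, StrictMonoOn g {x | x ∈ u} ∧ IsPF (u.map g) ∧
      ∀ v : W, v.Perm u → parkFuel k v = v.map g := by
  intro k
  induction k with
  | zero =>
    intro u hu hs
    have : u = [] := by
      cases u with
      | nil => rfl
      | cons x xs => have := hu x (by simp); simp at hs; omega
    subst this
    refine ⟨id, by intro x hx; simp at hx, ?_, ?_⟩
    · exact ⟨by simp, by simp⟩
    · intro v hv; simp [parkFuel]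
  | succ k ih =>
    intro u hu hs
    by_cases hd' : dVal u = u.length + 1
    · refine ⟨id, fun x _ y _ h => h, ?_, ?_⟩
      · rw [List.map_id]
        exact IsPF_of_count hu fun i hi => dVal_min u (by omega)
      · intro v hv
        rw [parkFuel, if_pos (by rw [dVal_perm hv, hd', hv.length_eq]), List.map_id]
    · have hle := dVal_le u
      have hlt : dVal u ≤ u.length := by omega
      have hsp := dVal_spec u
      have hnm := dVal_notMem u
      have hne : ∀ x ∈ u, x ≠ dVal u := fun x hx e => hnm (e ▸ hx)
      have hmono : StrictMonoOn (stepL (dVal u)) {x | x ∈ u} := by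
        intro x hx y hy hxy
        have := hne x hx
        have := hne y hy
        unfold stepL
        split_ifs <;> omega
      have hpos : ∀ x ∈ u.map (stepL (dVal u)), 1 ≤ x := by
        intro x hx
        obtain ⟨y, hy, rfl⟩ := List.mem_map.1 hx
        have := hu y hy
        unfold stepL
        split_ifs <;> omega
      have hex : ∃ x ∈ u, dVal u < x := by
        by_contra hcon
        push Not at hcon
        have : u.filter (fun x => decide (x ≤ dVal u)) = u := by
          rw [List.filter_eq_self]; intro x hx; simpa using hcon x hx
        rw [this] at hsp
        omega
      have hsum : (u.map (stepL (dVal u))).sum < u.sum := by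
        apply sum_map_lt
        · intro x _; unfold stepL; split_ifs <;> omega
        · obtain ⟨x, hx, hlt⟩ := hex
          refine ⟨x, hx, ?_⟩
          unfold stepL; rw [if_pos hlt]; omega
      obtain ⟨g, hg1, hg2, hg3⟩ := ih _ hpos (by omega)
      refine ⟨g ∘ stepL (dVal u), ?_, ?_, ?_⟩
      · intro x hx y hy hxy
        exact hg1 (List.mem_map.2 ⟨x, hx, rfl⟩) (List.mem_map.2 ⟨y, hy, rfl⟩) (hmono hx hy hxy)
      · rw [← List.map_map]; exact hg2
      · intro v hv
        rw [parkFuel, if_neg (by rw [dVal_perm hv, hv.length_eq]; exact hd'), parkStep_eq,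
          dVal_perm hv, hg3 _ (hv.map _), List.map_map]

theorem Park_spec (u : W) (hu : ∀ x ∈ u, 1 ≤ x) :
    ∃ g : ℕ → ℕ, StrictMonoOn g {x | x ∈ u} ∧ IsPF (u.map g) ∧
      ∀ v : W, v.Perm u → Park v = v.map g := by
  obtain ⟨g, h1, h2, h3⟩ := parkFuel_spec u.sum u hu le_rfl
  refine ⟨g, h1, h2, fun v hv => ?_⟩
  rw [Park, hv.sum_eq, h3 v hv]

/-- The finite upper set of a word. -/
noncomputable def UpW (u : W) : Finset W := u.permutations.toFinset.filter (fun b => leStar u b)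

theorem mem_UpW (u b : W) : b ∈ UpW u ↔ leStar u b := by
  simp only [UpW, Finset.mem_filter, List.mem_toFinset, List.mem_permutations]
  exact ⟨fun h => h.2, fun h => ⟨leStar_perm h, h⟩⟩

theorem pf_up {a : W} (ha : IsPF a) :
    (pfFinset a.length).filter (fun b => leStar a b) = UpW a := by
  ext b
  rw [Finset.mem_filter, mem_UpW, mem_pfFinset]
  exact ⟨fun h => h.2, fun h => ⟨⟨(leStar_perm h).length_eq, IsPF_perm (leStar_perm h).symm ha⟩, h⟩⟩

theorem Park_up (u : W) (hu : ∀ x ∈ u, 1 ≤ x) {M : Type} [AddCommMonoid M] (f : W → M) :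
    ∑ b ∈ (pfFinset (Park u).length).filter (fun b => leStar (Park u) b), f b =
      ∑ c ∈ UpW u, f (Park c) := by
  obtain ⟨g, h1, h2, h3⟩ := Park_spec u hu
  have hP := h3 u (.refl _)
  rw [pf_up (hP ▸ h2)]
  symm
  refine Finset.sum_bij (fun c _ => Park c) ?_ ?_ ?_ ?_
  · intro c hc
    rw [mem_UpW] at hc ⊢
    rw [hP, h3 c (leStar_perm hc)]
    exact leStar_map h1 hc
  · intro c hc d hd' e
    rw [mem_UpW] at hc hd'
    rw [h3 c (leStar_perm hc), h3 d (leStar_perm hd')] at e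
    exact map_inj_of h1 (leStar_perm hc) (leStar_perm hd') e
  · intro b hb
    rw [mem_UpW, hP] at hb
    obtain ⟨c, hc, rfl⟩ := leStar_map_rev h1 hb
    exact ⟨c, (mem_UpW _ _).2 hc, h3 c (leStar_perm hc)⟩
  · intro c _; rfl

theorem subWord_mem {a : W} {S : Finset W} {x : ℕ} (hx : x ∈ subWord a S) : x ∈ a := by
  rw [← wordOf_LR a]
  simp only [subWord, wordOf, List.mem_flatten, List.mem_reverse, List.mem_filter] at hx ⊢
  obtain ⟨l, hl, hx⟩ := hx
  exact ⟨l, hl.1, hx⟩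

theorem main_bij (a : W) {M : Type} [AddCommMonoid M] (f : W → W → M) :
    ∑ b ∈ UpW a, ∑ T ∈ (ph b).powerset, f (subWord b T) (subWord b (ph b \ T)) =
      ∑ S ∈ (ph a).powerset, ∑ c ∈ UpW (subWord a S), ∑ d ∈ UpW (subWord a (ph a \ S)), f c d := by
  symm
  simp_rw [← Finset.sum_product']
  rw [Finset.sum_sigma', Finset.sum_sigma']
  have hA := ph_good a
  have base : ∀ S : Finset W, S ⊆ ph a → ∀ c d : W, leStar (subWord a S) c →
      leStar (subWord a (ph a \ S)) d →
      SLe S (ph c) ∧ SLe (ph a \ S) (ph d) ∧ SLe (ph a) (ph c ∪ ph d) ∧ Disjoint (ph c) (ph d) := by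
    intro S hS c d hc hd'
    rw [leStar_iff, ph_subWord a S hS] at hc
    rw [leStar_iff, ph_subWord a _ Finset.sdiff_subset] at hd'
    have e : S ∪ ph a \ S = ph a := Finset.union_sdiff_of_subset hS
    have := SLe_union2 hc hd' (by rw [e]; exact hA) Finset.disjoint_sdiff
    rw [e] at this
    exact ⟨hc, hd', this⟩
  have hex : ∀ c d : W, ∃ b : W, GS (ph c ∪ ph d) → ph b = ph c ∪ ph d := by
    intro c d
    by_cases h : GS (ph c ∪ ph d)
    · obtain ⟨b, hb⟩ := exists_ph h
      exact ⟨b, fun _ => hb⟩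
    · exact ⟨[], fun h' => absurd h' h⟩
  choose J hJ using hex
  refine Finset.sum_bij (fun (p : Σ _ : Finset W, W × W) _ =>
    (⟨J p.2.1 p.2.2, ph p.2.1⟩ : Σ _ : W, Finset W)) ?_ ?_ ?_ ?_
  · rintro ⟨S, c, d⟩ h
    simp only [Finset.mem_sigma, Finset.mem_powerset, Finset.mem_product, mem_UpW] at h ⊢
    obtain ⟨h1, h2, h3, h4⟩ := base S h.1 c d h.2.1 h.2.2
    have hj := hJ c d (SLe_good h3 hA)
    rw [leStar_iff, hj]
    exact ⟨h3, Finset.subset_union_left⟩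
  · rintro ⟨S, c, d⟩ h ⟨S', c', d'⟩ h' e
    simp only [Finset.mem_sigma, Finset.mem_powerset, Finset.mem_product, mem_UpW] at h h'
    obtain ⟨h1, h2, h3, h4⟩ := base S h.1 c d h.2.1 h.2.2
    obtain ⟨h1', h2', h3', h4'⟩ := base S' h'.1 c' d' h'.2.1 h'.2.2
    have hj := hJ c d (SLe_good h3 hA)
    have hj' := hJ c' d' (SLe_good h3' hA)
    simp only [Sigma.mk.injEq, heq_eq_eq] at e
    obtain ⟨e1, e2⟩ := e
    rw [e1, hj'] at hj
    have ec := ph_inj e2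
    subst ec
    have ed : ph d = ph d' := by
      rw [← Finset.union_sdiff_cancel_left h4, ← Finset.union_sdiff_cancel_left h4', hj]
    have ed' := ph_inj ed
    subst ed'
    have := S_unique hA h.1 h'.1 h1 h1'
    subst this
    rfl
  · rintro ⟨b, T⟩ h
    simp only [Finset.mem_sigma, Finset.mem_powerset, mem_UpW] at h
    obtain ⟨hb, hT⟩ := h
    rw [leStar_iff] at hb
    obtain ⟨S, hS, s1, s2⟩ := SLe_split hb hA hT
    have e1 := ph_subWord b T hT
    have e2 := ph_subWord b (ph b \ T) Finset.sdiff_subset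
    have eu : ph (subWord b T) ∪ ph (subWord b (ph b \ T)) = ph b := by
      rw [e1, e2]; exact Finset.union_sdiff_of_subset hT
    refine ⟨⟨S, subWord b T, subWord b (ph b \ T)⟩, ?_, ?_⟩
    · simp only [Finset.mem_sigma, Finset.mem_powerset, Finset.mem_product, mem_UpW]
      rw [leStar_iff, leStar_iff, e1, e2, ph_subWord a S hS, ph_subWord a _ Finset.sdiff_subset]
      exact ⟨hS, s1, s2⟩
    · have hj := hJ (subWord b T) (subWord b (ph b \ T)) (by rw [eu]; exact ph_good b)
      rw [eu] at hj
      simp only [Sigma.mk.injEq, heq_eq_eq]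
      exact ⟨ph_inj hj, e1⟩
  · rintro ⟨S, c, d⟩ h
    simp only [Finset.mem_sigma, Finset.mem_powerset, Finset.mem_product, mem_UpW] at h
    obtain ⟨h1, h2, h3, h4⟩ := base S h.1 c d h.2.1 h.2.2
    have hj := hJ c d (SLe_good h3 hA)
    have ec : subWord (J c d) (ph c) = c :=
      ph_inj (ph_subWord _ _ (by rw [hj]; exact Finset.subset_union_left))
    have ed : subWord (J c d) (ph (J c d) \ ph c) = d := by
      apply ph_inj
      rw [ph_subWord _ _ Finset.sdiff_subset, hj, Finset.union_sdiff_cancel_left h4]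
    simp only [ec, ed]

/-- For every parking function `a`:
`Δ(Q_a) = Σ Q_{Park a'} ⊗ Q_{Park a''}`, summed over ordered pairs `(a', a'')`
of subwords of `a` with `F_{a'} ⊍ F_{a''} = F_a` (encoded by the subset
`S ⊆ F_a` of words kept in `a'`). -/
theorem stmt13 (K : Type) [Field K] [CharZero K] (a : W) (ha : IsPF a) :
    deltaF K (Qb K a) =
      ∑ S ∈ ((LR a).toFinset).powerset,
        QT K (Park (subWord a S)) (Park (subWord a (((LR a).toFinset) \ S))) := by
  rw [Qb, pf_up ha]
  have hlin : deltaF K (∑ b ∈ UpW a, Mb K b) = ∑ b ∈ UpW a, deltaSingle K b := by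
    have : ∀ x : FW K, deltaF K x = Finsupp.linearCombination K (deltaSingle K) x := by
      intro x; rw [Finsupp.linearCombination_apply]; rfl
    rw [this, map_sum]
    refine Finset.sum_congr rfl fun b _ => ?_
    rw [Mb, Finsupp.linearCombination_single, one_smul]
  rw [hlin]
  have hm := main_bij a (fun c d => (Finsupp.single (Park c, Park d) 1 : FW2 K))
  refine hm.trans (Finset.sum_congr rfl fun S _ => ?_)
  have hpos : ∀ T : Finset W, ∀ x ∈ subWord a T, 1 ≤ x := fun T x hx => ha.1 x (subWord_mem hx)
  rw [QT, Park_up (subWord a S) (hpos _)]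
  refine Finset.sum_congr rfl fun c _ => ?_
  rw [Park_up (subWord a ((LR a).toFinset \ S)) (hpos _)]
  rfl
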